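/- Let m be a positive integer and ξ a U_m-number. Then for every integer n ≥ 1, ŵ*_n(ξ) ≤ m and ŵ_n(ξ) ≤ m + n - 1. -/

import Mathlib

open Polynomial Filter

/-- Height of an integer polynomial: the maximum absolute value of its coefficients. -/
noncomputable def polyHeight (P : Polynomial ℤ) : ℝ :=
  ((P.support.sup fun i => (P.coeff i).natAbs : ℕ) : ℝ)

/-- `P` and `Q` have no common non-constant factor in `ℤ[X]`. -/
def CoprimePoly (P Q : Polynomial ℤ) : Prop :=
  ∀ d : Polynomial ℤ, d ∣ P → d ∣ Q → d.natDegree = 0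

/-- The exponent `w_n(ξ)`. -/
noncomputable def wExp (n : ℕ) (ξ : ℝ) : EReal :=
  sSup {x : EReal | ∃ w : ℝ, x = (w : EReal) ∧
    {P : Polynomial ℤ | P.natDegree ≤ n ∧ 0 < |Polynomial.aeval ξ P| ∧
      |Polynomial.aeval ξ P| ≤ (polyHeight P) ^ (-w)}.Infinite}

/-- The uniform exponent `ŵ_n(ξ)`. -/
noncomputable def whExp (n : ℕ) (ξ : ℝ) : EReal :=
  sSup {x : EReal | ∃ w : ℝ, x = (w : EReal) ∧
    ∀ᶠ H : ℝ in atTop, ∃ P : Polynomial ℤ, P.natDegree ≤ n ∧ polyHeight P ≤ H ∧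
      0 < |Polynomial.aeval ξ P| ∧ |Polynomial.aeval ξ P| ≤ H ^ (-w)}

/-- The exponent `w*_n(ξ)` of approximation by algebraic numbers of degree at most `n`;
the height of an algebraic number is the height of its irreducible defining polynomial. -/
noncomputable def wStarExp (n : ℕ) (ξ : ℝ) : EReal :=
  sSup {x : EReal | ∃ w : ℝ, x = (w : EReal) ∧
    {α : ℝ | ∃ P : Polynomial ℤ, Irreducible P ∧ Polynomial.aeval α P = 0 ∧
      P.natDegree ≤ n ∧ 0 < |ξ - α| ∧ |ξ - α| ≤ (polyHeight P) ^ (-w - 1)}.Infinite}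

/-- The uniform exponent `ŵ*_n(ξ)`. -/
noncomputable def whStarExp (n : ℕ) (ξ : ℝ) : EReal :=
  sSup {x : EReal | ∃ w : ℝ, x = (w : EReal) ∧
    ∀ᶠ H : ℝ in atTop, ∃ α : ℝ, ∃ P : Polynomial ℤ, Irreducible P ∧
      Polynomial.aeval α P = 0 ∧ P.natDegree ≤ n ∧ polyHeight P ≤ H ∧
      0 < |ξ - α| ∧ |ξ - α| ≤ (polyHeight P)⁻¹ * H ^ (-w)}

theorem abs_coeff_le_polyHeight (P : ℤ[X]) (i : ℕ) : |(P.coeff i : ℝ)| ≤ polyHeight P := by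
  by_cases h : i ∈ P.support
  · rw [← Int.cast_abs, ← Nat.cast_natAbs, polyHeight, Nat.cast_le]
    exact Finset.le_sup (f := fun i => (P.coeff i).natAbs) h
  · rw [notMem_support_iff.mp h]
    simp [polyHeight]

theorem one_le_polyHeight {P : ℤ[X]} (hP : P ≠ 0) : 1 ≤ polyHeight P := by
  refine le_trans ?_ (abs_coeff_le_polyHeight P P.natDegree)
  rw [← Int.cast_abs]
  exact_mod_cast Int.one_le_abs (leadingCoeff_ne_zero.mpr hP)

theorem polyHeight_le {P : ℤ[X]} {B : ℝ} (hB : 0 ≤ B) (h : ∀ i, |(P.coeff i : ℝ)| ≤ B) :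
    polyHeight P ≤ B := by
  rw [polyHeight, ← Nat.le_floor_iff hB, Finset.sup_le_iff]
  intro i _
  rw [Nat.le_floor_iff hB, Nat.cast_natAbs, Int.cast_abs]
  exact h i

theorem mahlerMeasure_le_polyHeight {P : ℤ[X]} {n : ℕ} (hP : P.natDegree ≤ n) :
    (P.map (Int.castRingHom ℂ)).mahlerMeasure ≤ (n + 1) * polyHeight P := by
  refine (mahlerMeasure_le_sum_norm_coeff _).trans ?_
  rw [sum_over_range' _ (by simp) (n + 1) (by grind [natDegree_map_le])]
  calc _ ≤ ∑ _i ∈ Finset.range (n + 1), polyHeight P := by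
        gcongr with i
        simpa using abs_coeff_le_polyHeight P i
    _ = _ := by simp

theorem finite_polyHeight_le (n : ℕ) (B : ℝ) :
    {P : ℤ[X] | P.natDegree ≤ n ∧ polyHeight P ≤ B}.Finite := by
  refine (finite_mahlerMeasure_le n ((n + 1) * B).toNNReal).subset fun P ⟨hd, hB⟩ => ⟨hd, ?_⟩
  refine ((mahlerMeasure_le_polyHeight hd).trans ?_).trans (Real.le_coe_toNNReal _)
  gcongr

/-- Gelfond's inequality: divisors have comparable height. -/
theorem polyHeight_le_of_dvd {P Q : ℤ[X]} {n : ℕ} (hQ : Q.natDegree ≤ n) (hQ0 : Q ≠ 0)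
    (h : P ∣ Q) : polyHeight P ≤ 2 ^ n * (n + 1) * polyHeight Q := by
  obtain ⟨R, rfl⟩ := h
  have hP0 : P ≠ 0 := left_ne_zero_of_mul hQ0
  have hR0 : R ≠ 0 := right_ne_zero_of_mul hQ0
  have hH := one_le_polyHeight hQ0
  refine polyHeight_le (by positivity) fun i => ?_
  have h1 := norm_coeff_le_choose_mul_mahlerMeasure i (P.map (Int.castRingHom ℂ))
  have h2 : (((P.map (Int.castRingHom ℂ)).natDegree.choose i : ℕ) : ℝ) ≤ 2 ^ n := by
    have : (P.map (Int.castRingHom ℂ)).natDegree ≤ n := by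
      refine natDegree_map_le.trans (le_trans ?_ hQ)
      rw [natDegree_mul hP0 hR0]
      omega
    exact_mod_cast (Nat.choose_le_two_pow _ _).trans (Nat.pow_le_pow_right two_pos this)
  have h3 : (P.map (Int.castRingHom ℂ)).mahlerMeasure ≤ (n + 1) * polyHeight (P * R) := by
    refine le_trans ?_ (mahlerMeasure_le_polyHeight hQ)
    rw [Polynomial.map_mul, mahlerMeasure_mul]
    exact le_mul_of_one_le_right (mahlerMeasure_nonneg _) (one_le_mahlerMeasure_of_ne_zero hR0)
  calc |(P.coeff i : ℝ)| = ‖(P.map (Int.castRingHom ℂ)).coeff i‖ := by simp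
    _ ≤ _ := h1
    _ ≤ 2 ^ n * ((n + 1) * polyHeight (P * R)) := by
        gcongr
        exact mahlerMeasure_nonneg _
    _ = _ := by ring

theorem abs_aeval_pos {ξ : ℝ} (hξ : Transcendental ℚ ξ) {P : ℤ[X]} (hP : P ≠ 0) :
    0 < |aeval ξ P| := by
  have h : Transcendental ℤ ξ := hξ.restrictScalars Int.cast_injective
  exact abs_pos.mpr fun h0 => h ⟨P, hP, h0⟩

theorem Matrix.abs_det_le_prod_mul_prod {ι : Type*} [Fintype ι] [DecidableEq ι] {A : Matrix ι ι ℝ}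
    {r d : ι → ℝ} (h : ∀ i j, |A i j| ≤ r i * d j) :
    |A.det| ≤ (Fintype.card ι).factorial * ((∏ i, r i) * ∏ j, d j) := by
  rw [← Matrix.det_transpose, Matrix.det_apply']
  calc _ ≤ ∑ σ : Equiv.Perm ι, |(Equiv.Perm.sign σ : ℝ) * ∏ i, A.transpose (σ i) i| :=
        Finset.abs_sum_le_sum_abs _ _
    _ ≤ ∑ _σ : Equiv.Perm ι, (∏ i, r i) * ∏ j, d j := by
        gcongr with σ
        rw [abs_mul, Finset.abs_prod, ← Equiv.prod_comp σ d, ← Finset.prod_mul_distrib]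
        have : |((Equiv.Perm.sign σ : ℤ) : ℝ)| = 1 := by
          rcases Int.units_eq_one_or (Equiv.Perm.sign σ) with h | h <;> simp [h]
        rw [this, one_mul]
        exact Finset.prod_le_prod (fun _ _ => abs_nonneg _) fun i _ => h _ _
    _ = _ := by simp [Fintype.card_perm]

theorem one_le_of_linearIndependent {ι : Type*} [Fintype ι] [DecidableEq ι] {N : ℕ}
    (e : ι ≃ Fin N) (hN : 0 < N) {f : ι → ℤ[X]} (hf : LinearIndependent ℤ f)
    (hd : ∀ i, (f i).natDegree < N) {r : ι → ℝ} (hr : ∀ i, 0 < r i)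
    (hfr : ∀ i, polyHeight (f i) ≤ r i) (ξ : ℝ) :
    1 ≤ (N.factorial : ℝ) * ((∏ i, r i) * ∑ i, |aeval ξ (f i)| / r i) := by
  set M : Matrix ι ι ℤ := fun i j => (f i).coeff (e j) with hM
  have hdet : M.det ≠ 0 := by
    rw [Ne, ← Matrix.exists_vecMul_eq_zero_iff]
    rintro ⟨v, hv, hv0⟩
    apply hv
    ext i
    refine Fintype.linearIndependent_iff.mp hf v ?_ i
    ext k
    by_cases hk : k < N
    · have := congrFun hv0 (e.symm ⟨k, hk⟩)
      simpa [Matrix.vecMul, dotProduct, hM] using this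
    · simp only [finsetSum_coeff, coeff_smul, coeff_zero]
      refine Finset.sum_eq_zero fun i _ => ?_
      rw [coeff_eq_zero_of_natDegree_lt ((hd i).trans_le (not_lt.mp hk)), smul_zero]
  set A : Matrix ι ι ℝ := M.map (Int.castRingHom ℝ) with hA
  have hAij : ∀ i j, A i j = ((f i).coeff (e j) : ℝ) := fun _ _ => rfl
  have hAdet : 1 ≤ |A.det| := by
    rw [hA, ← RingHom.mapMatrix_apply, ← RingHom.map_det]
    simpa [← Int.cast_abs] using (by exact_mod_cast Int.one_le_abs hdet : (1 : ℝ) ≤ |(M.det : ℝ)|)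
  set v : ι → ℝ := fun j => ξ ^ (e j : ℕ) with hv
  set b : ι → ℝ := fun i => aeval ξ (f i) with hb
  have hAv : A.mulVec v = b := by
    ext i
    simp only [hb]
    rw [aeval_eq_sum_range' (hd i), ← Fin.sum_univ_eq_sum_range
      (fun k => (f i).coeff k • ξ ^ k) N, ← Equiv.sum_comp e]
    simp [Matrix.mulVec, dotProduct, hAij, hv]
  set j₀ : ι := e.symm ⟨0, hN⟩ with hj₀
  have hcr : (A.updateCol j₀ b).det = A.det := by
    rw [← Matrix.cramer_apply, Matrix.cramer_eq_adjugate_mulVec, ← hAv, Matrix.mulVec_mulVec,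
      Matrix.adjugate_mul, Matrix.smul_mulVec, Matrix.one_mulVec]
    simp [hv, hj₀]
  have hD : ∀ i, |b i| / r i ≤ ∑ i, |b i| / r i := fun i =>
    Finset.single_le_sum (f := fun i => |b i| / r i)
      (fun i _ => div_nonneg (abs_nonneg _) (hr i).le) (Finset.mem_univ i)
  have hbd := Matrix.abs_det_le_prod_mul_prod (A := A.updateCol j₀ b) (r := r)
    (d := Function.update 1 j₀ (∑ i, |b i| / r i)) fun i j => by
      rcases eq_or_ne j j₀ with rfl | hj
      · have := hD i
        rw [div_le_iff₀' (hr i)] at this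
        simpa using this
      · simpa [hj, hAij] using (abs_coeff_le_polyHeight _ _).trans (hfr i)
  rw [hcr, Finset.prod_update_of_mem (Finset.mem_univ _), Fintype.card_congr e,
    Fintype.card_fin] at hbd
  simpa using hAdet.trans hbd

theorem polyHeight_mul_X_pow (P : ℤ[X]) (k : ℕ) : polyHeight (P * X ^ k) = polyHeight P := by
  apply le_antisymm
  · refine polyHeight_le (Nat.cast_nonneg _) fun i => ?_
    rw [coeff_mul_X_pow']
    split_ifs
    · exact abs_coeff_le_polyHeight _ _
    · simp [polyHeight]
  · refine polyHeight_le (Nat.cast_nonneg _) fun i => ?_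
    rw [← coeff_mul_X_pow P k i]
    exact abs_coeff_le_polyHeight _ _

/-- The rows of the Sylvester matrix of `P` and `Q`, as polynomials. -/
noncomputable def sylvesterRow (n m : ℕ) (P Q : ℤ[X]) : Fin n ⊕ Fin m → ℤ[X] :=
  Sum.elim (fun i => P * X ^ (i : ℕ)) (fun j => Q * X ^ (j : ℕ))

theorem linearIndependent_sylvesterRow {n m : ℕ} {P Q : ℤ[X]} (hP : Irreducible P)
    (hPm : P.natDegree = m) (hPQ : ¬ P ∣ Q) :
    LinearIndependent ℤ (sylvesterRow n m P Q) := by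
  have key : ∀ (k : ℕ) (c : Fin k → ℤ), (∑ i, C (c i) * X ^ (i : ℕ)) = 0 → ∀ i, c i = 0 := by
    intro k c h i
    have := congrArg (coeff · (i : ℕ)) h
    simpa [finsetSum_coeff, coeff_X_pow, Fin.val_inj] using this
  rw [Fintype.linearIndependent_iff]
  intro c hc
  set A : ℤ[X] := ∑ i : Fin n, C (c (Sum.inl i)) * X ^ (i : ℕ) with hA
  set B : ℤ[X] := ∑ j : Fin m, C (c (Sum.inr j)) * X ^ (j : ℕ) with hB
  have hsum : P * A + Q * B = 0 := by
    rw [← hc, Fintype.sum_sum_type, hA, hB, Finset.mul_sum, Finset.mul_sum]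
    simp only [sylvesterRow, Sum.elim_inl, Sum.elim_inr, smul_eq_C_mul]
    congr 1 <;> exact Finset.sum_congr rfl fun _ _ => by ring
  have hdvd : P ∣ Q * B := ⟨-A, by linear_combination hsum⟩
  have hB0 : B = 0 := by
    by_contra hne
    have h1 := natDegree_le_of_dvd ((hP.prime.dvd_or_dvd hdvd).resolve_left hPQ) hne
    have h2 : B.degree < m := degree_sum_fin_lt _
    rw [degree_eq_natDegree hne, Nat.cast_lt] at h2
    omega
  have hA0 : A = 0 := by
    rw [hB0, mul_zero, add_zero] at hsum
    exact (mul_eq_zero.mp hsum).resolve_left hP.ne_zero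
  rintro (i | j)
  · exact key n (fun i => c (Sum.inl i)) hA0 i
  · exact key m (fun j => c (Sum.inr j)) hB0 j

theorem exists_one_le_resultant_bound (m n : ℕ) (hm : 1 ≤ m) (ξ : ℝ) :
    ∃ C : ℝ, 1 ≤ C ∧ ∀ P Q : ℤ[X], Irreducible P → P.natDegree = m → Q.natDegree ≤ n → ¬ P ∣ Q →
      ∀ h H : ℝ, 0 < h → 0 < H → polyHeight P ≤ h → polyHeight Q ≤ H →
        1 ≤ C * (h ^ n * H ^ m * (|aeval ξ P| / h + |aeval ξ Q| / H)) := by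
  set K : ℝ := max 1 |ξ| with hK
  have hK1 : 1 ≤ K := le_max_left _ _
  set C₀ : ℝ := (n + m).factorial * ((n + m) * K ^ (n + m)) with hC₀
  refine ⟨max 1 C₀, le_max_left _ _, fun P Q hP hPm hQn hPQ h H hh hH hPh hQH => ?_⟩
  have hS : 0 ≤ h ^ n * H ^ m * (|aeval ξ P| / h + |aeval ξ Q| / H) := by positivity
  refine le_trans ?_ (mul_le_mul_of_nonneg_right (le_max_right 1 C₀) hS)
  have hX : ∀ k < n + m, |ξ| ^ k ≤ K ^ (n + m) := fun k hk =>
    (pow_le_pow_left₀ (abs_nonneg _) (le_max_right _ _) k).trans (pow_le_pow_right₀ hK1 hk.le)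
  have hrow := one_le_of_linearIndependent (finSumFinEquiv (m := n) (n := m)) (by omega)
    (linearIndependent_sylvesterRow (n := n) hP hPm hPQ) (r := Sum.elim (fun _ => h) (fun _ => H))
    (by
      rintro (i | j)
      · refine natDegree_mul_le.trans_lt ?_
        simp only [natDegree_X_pow]
        omega
      · refine natDegree_mul_le.trans_lt ?_
        simp only [natDegree_X_pow]
        omega)
    (by rintro (i | j) <;> simpa)
    (by rintro (i | j) <;> simpa [sylvesterRow, polyHeight_mul_X_pow]) ξ
  refine hrow.trans ?_
  rw [hC₀, mul_assoc]
  refine mul_le_mul_of_nonneg_left ?_ (Nat.cast_nonneg _)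
  simp only [Fintype.prod_sum_type, Fintype.sum_sum_type, Sum.elim_inl, Sum.elim_inr,
    Finset.prod_const, Finset.card_univ, Fintype.card_fin, sylvesterRow]
  rw [mul_left_comm]
  refine mul_le_mul_of_nonneg_left ?_ (by positivity)
  calc _ ≤ ∑ _i : Fin n, |aeval ξ P| / h * K ^ (n + m) +
        ∑ _j : Fin m, |aeval ξ Q| / H * K ^ (n + m) := by
        gcongr with i _ j _
        · rw [map_mul, abs_mul, map_pow, aeval_X, abs_pow, mul_div_right_comm]
          gcongr
          exact hX _ (by omega)
        · rw [map_mul, abs_mul, map_pow, aeval_X, abs_pow, mul_div_right_comm]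
          gcongr
          exact hX _ (by omega)
    _ = (n : ℝ) * (|aeval ξ P| / h * K ^ (n + m)) + m * (|aeval ξ Q| / H * K ^ (n + m)) := by
        simp
    _ ≤ (n + m) * (|aeval ξ P| / h * K ^ (n + m)) +
        (n + m) * (|aeval ξ Q| / H * K ^ (n + m)) := by
        gcongr <;> simp
    _ = _ := by ring

theorem exists_abs_aeval_le_of_root (n : ℕ) (ξ : ℝ) :
    ∃ C : ℝ, 1 ≤ C ∧ ∀ (Q : ℤ[X]) (α : ℝ), Q.natDegree ≤ n → aeval α Q = 0 → |ξ - α| ≤ 1 →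
      |aeval ξ Q| ≤ C * (polyHeight Q * |ξ - α|) := by
  set K : ℝ := |ξ| + 1 with hK
  have hK1 : 1 ≤ K := by simp [hK]
  refine ⟨(n + 1) * ((n + 1) * K ^ n), ?_, fun Q α hQ hα hξα => ?_⟩
  · have h1 : (1 : ℝ) ≤ n + 1 := by simp
    exact one_le_mul_of_one_le_of_one_le h1 (one_le_mul_of_one_le_of_one_le h1 (one_le_pow₀ hK1))
  have hmax : max |ξ| |α| ≤ K := by
    refine max_le (by simp [hK]) ?_
    have := abs_sub_abs_le_abs_sub α ξ
    rw [abs_sub_comm] at this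
    linarith
  have hd : Q.natDegree < n + 1 := by omega
  have hH : 0 ≤ polyHeight Q := Nat.cast_nonneg _
  calc |aeval ξ Q| = |aeval ξ Q - aeval α Q| := by rw [hα, sub_zero]
    _ = |∑ i ∈ Finset.range (n + 1), (Q.coeff i : ℝ) * (ξ ^ i - α ^ i)| := by
        rw [aeval_eq_sum_range' hd, aeval_eq_sum_range' hd, ← Finset.sum_sub_distrib]
        simp [mul_sub]
    _ ≤ ∑ i ∈ Finset.range (n + 1), |(Q.coeff i : ℝ) * (ξ ^ i - α ^ i)| :=
        Finset.abs_sum_le_sum_abs _ _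
    _ ≤ ∑ _i ∈ Finset.range (n + 1), polyHeight Q * (|ξ - α| * (n + 1) * K ^ n) := by
        refine Finset.sum_le_sum fun i hi => ?_
        rw [Finset.mem_range] at hi
        rw [abs_mul]
        refine mul_le_mul (abs_coeff_le_polyHeight _ _) ?_ (abs_nonneg _) hH
        refine (abs_pow_sub_pow_le _ _ _).trans ?_
        have hi' : (i : ℝ) ≤ n + 1 := by exact_mod_cast hi.le
        have hp : max |ξ| |α| ^ (i - 1) ≤ K ^ n :=
          (pow_le_pow_left₀ (by positivity) hmax _).trans (pow_le_pow_right₀ hK1 (by omega))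
        gcongr
    _ = _ := by
        simp
        ring

theorem exists_pos_lower_bound {β : Type*} {S T : Set β} (hT : T.Finite) {g : β → ℝ}
    (hpos : ∀ x ∈ S, 0 < g x) (hg : ∀ x ∈ S, x ∉ T → 1 ≤ g x) :
    ∃ c : ℝ, 0 < c ∧ ∀ x ∈ S, c ≤ g x := by
  have hfin : (T ∩ S).Finite := hT.subset Set.inter_subset_left
  rcases (T ∩ S).eq_empty_or_nonempty with he | hne
  · refine ⟨1, one_pos, fun x hx => hg x hx fun hxT => ?_⟩
    exact (Set.ext_iff.mp he x).mp ⟨hxT, hx⟩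
  · obtain ⟨y, hy, hmin⟩ := Set.exists_min_image _ g hfin hne
    refine ⟨min 1 (g y), lt_min one_pos (hpos y hy.2), fun x hx => ?_⟩
    by_cases hxT : x ∈ T
    · exact (min_le_right _ _).trans (hmin x ⟨hxT, hx⟩)
    · exact (min_le_left _ _).trans (hg x hx hxT)

theorem exists_lower_bound_of_wExp_lt_top {n : ℕ} {ξ : ℝ} (hξ : Transcendental ℚ ξ)
    (h : wExp n ξ < ⊤) :
    ∃ (c : ℝ) (W : ℕ), 0 < c ∧
      ∀ P : ℤ[X], P.natDegree ≤ n → P ≠ 0 → c ≤ |aeval ξ P| * polyHeight P ^ W := by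
  obtain ⟨w, hw, -⟩ := EReal.lt_iff_exists_real_btwn.mp h
  obtain ⟨W, hW⟩ := exists_nat_ge w
  have hfin : {P : ℤ[X] | P.natDegree ≤ n ∧ 0 < |aeval ξ P| ∧
      |aeval ξ P| ≤ polyHeight P ^ (-(W : ℝ))}.Finite := by
    by_contra hinf
    have h1 : ((W : ℝ) : EReal) ≤ wExp n ξ := le_sSup ⟨W, rfl, hinf⟩
    exact absurd (h1.trans_lt hw) (not_lt.mpr (EReal.coe_le_coe_iff.mpr hW))
  obtain ⟨c, hc, hcS⟩ := exists_pos_lower_bound (S := {P : ℤ[X] | P.natDegree ≤ n ∧ P ≠ 0})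
    hfin (g := fun P => |aeval ξ P| * polyHeight P ^ W)
    (fun P hP => mul_pos (abs_aeval_pos hξ hP.2)
      (pow_pos (one_pos.trans_le (one_le_polyHeight hP.2)) _))
    (fun P hP hPT => by
      have hH := one_pos.trans_le (one_le_polyHeight hP.2)
      have h2 : polyHeight P ^ (-(W : ℝ)) < |aeval ξ P| := by
        by_contra hle
        exact hPT ⟨hP.1, abs_aeval_pos hξ hP.2, not_lt.mp hle⟩
      rw [Real.rpow_neg hH.le, Real.rpow_natCast, inv_lt_iff_one_lt_mul₀ (pow_pos hH _)] at h2
      simpa only [mul_comm] using h2.le)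
  exact ⟨c, W, hc, fun P hd h0 => hcS P ⟨hd, h0⟩⟩

theorem wExp_lt_top_of_lower_bound {n : ℕ} {ξ c : ℝ} {W : ℕ} (hc : 0 < c)
    (h : ∀ P : ℤ[X], P.natDegree ≤ n → P ≠ 0 → c ≤ |aeval ξ P| * polyHeight P ^ W) :
    wExp n ξ < ⊤ := by
  refine lt_of_le_of_lt (b := ((W + 1 : ℝ) : EReal)) (sSup_le ?_) (EReal.coe_lt_top _)
  rintro _ ⟨w, rfl, hinf⟩
  rw [EReal.coe_le_coe_iff]
  by_contra! hw
  refine hinf ((finite_polyHeight_le n c⁻¹).subset fun P ⟨hd, hpos, hle⟩ => ⟨hd, ?_⟩)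
  have hP : P ≠ 0 := by
    rintro rfl
    simp at hpos
  have hH1 := one_le_polyHeight hP
  have hH := one_pos.trans_le hH1
  have h2 : |aeval ξ P| ≤ (polyHeight P ^ (W + 1))⁻¹ := by
    refine hle.trans ?_
    rw [← Real.rpow_natCast, ← Real.rpow_neg hH.le]
    refine Real.rpow_le_rpow_of_exponent_le hH1 ?_
    push_cast
    linarith
  have h3 : c ≤ (polyHeight P)⁻¹ := by
    refine (h P hd hP).trans ((mul_le_mul_of_nonneg_right h2 (by positivity)).trans_eq ?_)
    field_simp
    rw [pow_succ]
  rwa [le_inv_comm₀ hH hc]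

theorem exists_factorization (P : ℤ[X]) (hd : P.natDegree ≠ 0) :
    ∃ k : ℤ, k ≠ 0 ∧ ∃ R : ℤ[X], P = C k * R ∧ R.natDegree = P.natDegree ∧
      (Irreducible R ∨ ∃ A B : ℤ[X], R = A * B ∧ A.natDegree < P.natDegree ∧
        B.natDegree < P.natDegree) := by
  have hP : P ≠ 0 := by
    rintro rfl
    simp at hd
  refine ⟨P.content, by simpa [content_eq_zero_iff], P.primPart, P.eq_C_content_mul_primPart,
    P.natDegree_primPart, ?_⟩
  by_cases hirr : Irreducible P.primPart
  · exact Or.inl hirr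
  right
  have hnu : ¬ IsUnit P.primPart := fun hu => hd (by
    rw [← P.natDegree_primPart]
    exact natDegree_eq_zero_of_isUnit hu)
  have hpos : ∀ A B : ℤ[X], P.primPart = A * B → ¬ IsUnit A → A.natDegree ≠ 0 := by
    intro A B hAB hA h0
    obtain ⟨a, rfl⟩ := natDegree_eq_zero.mp h0
    exact hA (isUnit_C.mpr (P.isPrimitive_primPart a ⟨B, hAB⟩))
  rw [irreducible_iff] at hirr
  push Not at hirr
  obtain ⟨A, B, hAB, hA, hB⟩ := hirr hnu
  have h0 : A * B ≠ 0 := hAB ▸ P.primPart_ne_zero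
  have hdeg := P.natDegree_primPart
  rw [hAB, natDegree_mul (left_ne_zero_of_mul h0) (right_ne_zero_of_mul h0)] at hdeg
  have h1 := hpos A B hAB hA
  have h2 := hpos B A (hAB.trans (mul_comm _ _)) hB
  exact ⟨A, B, hAB, by omega, by omega⟩

/-- A `U_m`-number has arbitrarily good approximations by irreducible polynomials of degree
exactly `m`. -/
theorem exists_irreducible_approximation {m : ℕ} (hm : 1 ≤ m) {ξ : ℝ} (hξ : Transcendental ℚ ξ)
    (hU1 : wExp m ξ = ⊤) (hU2 : wExp (m - 1) ξ < ⊤) (W : ℕ) (B : ℝ) :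
    ∃ P : ℤ[X], Irreducible P ∧ P.natDegree = m ∧ B ≤ polyHeight P ∧
      |aeval ξ P| * polyHeight P ^ W ≤ 1 := by
  by_contra! hno
  obtain ⟨c₀, W₀, hc₀, hlow⟩ := exists_lower_bound_of_wExp_lt_top hξ hU2
  obtain ⟨c₁, hc₁, hirr⟩ := exists_pos_lower_bound
    (S := {P : ℤ[X] | Irreducible P ∧ P.natDegree = m}) (finite_polyHeight_le m B)
    (g := fun P => |aeval ξ P| * polyHeight P ^ W)
    (fun P hP => mul_pos (abs_aeval_pos hξ hP.1.ne_zero)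
      (pow_pos (one_pos.trans_le (one_le_polyHeight hP.1.ne_zero)) _))
    (fun P hP hPT => (hno P hP.1 hP.2
      (not_le.mp fun hle => hPT ⟨hP.2.le, hle⟩).le).le)
  set c := min c₀ c₁
  have hcpos : 0 < c := lt_min hc₀ hc₁
  set U := W₀ + W with hU
  have hsmall : ∀ R : ℤ[X], R ≠ 0 → (R.natDegree < m ∨ Irreducible R ∧ R.natDegree = m) →
      c ≤ |aeval ξ R| * polyHeight R ^ U := by
    rintro R hR (hd | hI)
    · refine (min_le_left _ _).trans ((hlow R (by omega) hR).trans ?_)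
      exact mul_le_mul_of_nonneg_left
        (pow_le_pow_right₀ (one_le_polyHeight hR) (by omega)) (abs_nonneg _)
    · refine (min_le_right _ _).trans ((hirr R hI).trans ?_)
      exact mul_le_mul_of_nonneg_left
        (pow_le_pow_right₀ (one_le_polyHeight hR) (by omega)) (abs_nonneg _)
  set G : ℝ := 2 ^ m * (m + 1) with hG
  have hG1 : 1 ≤ G := one_le_mul_of_one_le_of_one_le (one_le_pow₀ one_le_two) (by simp)
  have hprod : ∀ P : ℤ[X], P.natDegree ≤ m → P ≠ 0 → ∃ k : ℤ, k ≠ 0 ∧ ∃ A B : ℤ[X],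
      P = C k * (A * B) ∧ (A.natDegree < m ∨ Irreducible A ∧ A.natDegree = m) ∧
      (B.natDegree < m ∨ Irreducible B ∧ B.natDegree = m) := by
    intro P hPd hP
    rcases hPd.lt_or_eq with hlt | heq
    · exact ⟨1, one_ne_zero, P, 1, by simp, Or.inl hlt, Or.inl (by simp; omega)⟩
    · obtain ⟨k, hk, R, hPR, hRd, hR | ⟨A, B, rfl, hA, hB⟩⟩ := exists_factorization P (by omega)
      · exact ⟨k, hk, R, 1, by simpa using hPR, Or.inr ⟨hR, hRd.trans heq⟩,
          Or.inl (by simp; omega)⟩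
      · exact ⟨k, hk, A, B, hPR, Or.inl (heq ▸ hA), Or.inl (heq ▸ hB)⟩
  refine (wExp_lt_top_of_lower_bound (n := m) (ξ := ξ) (c := c * c / G ^ (2 * U)) (W := 2 * U)
    (by positivity) fun P hPd hP => ?_).ne hU1
  obtain ⟨k, hk, A, B, hPAB, hA, hB⟩ := hprod P hPd hP
  have hAB : A * B ≠ 0 := right_ne_zero_of_mul (hPAB ▸ hP)
  have hA0 := left_ne_zero_of_mul hAB
  have hB0 := right_ne_zero_of_mul hAB
  have hHA : polyHeight A ≤ G * polyHeight P :=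
    polyHeight_le_of_dvd hPd hP ⟨C k * B, by rw [hPAB]; ring⟩
  have hHB : polyHeight B ≤ G * polyHeight P :=
    polyHeight_le_of_dvd hPd hP ⟨C k * A, by rw [hPAB]; ring⟩
  have hAnn : 0 ≤ polyHeight A := Nat.cast_nonneg _
  have hBnn : 0 ≤ polyHeight B := Nat.cast_nonneg _
  have hPnn : 0 ≤ polyHeight P := Nat.cast_nonneg _
  have hk1 : (1 : ℝ) ≤ |(k : ℝ)| := by
    rw [← Int.cast_abs]
    exact_mod_cast Int.one_le_abs hk
  have hval : |aeval ξ A| * |aeval ξ B| ≤ |aeval ξ P| := by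
    rw [hPAB, map_mul, map_mul, abs_mul, abs_mul]
    refine le_mul_of_one_le_left (by positivity) ?_
    simpa using hk1
  rw [div_le_iff₀ (by positivity)]
  clear_value G U
  calc c * c ≤ (|aeval ξ A| * polyHeight A ^ U) * (|aeval ξ B| * polyHeight B ^ U) :=
        mul_le_mul (hsmall A hA0 hA) (hsmall B hB0 hB) hcpos.le (by positivity)
    _ ≤ (|aeval ξ A| * (G * polyHeight P) ^ U) * (|aeval ξ B| * (G * polyHeight P) ^ U) := by
        gcongr
    _ = (|aeval ξ A| * |aeval ξ B|) * (polyHeight P ^ (2 * U) * G ^ (2 * U)) := by ring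
    _ ≤ |aeval ξ P| * (polyHeight P ^ (2 * U) * G ^ (2 * U)) := by gcongr
    _ = _ := by ring

theorem whStarExp_le_of_wExp {m : ℕ} (hm : 1 ≤ m) {ξ : ℝ} (hξ : Transcendental ℚ ξ)
    (hU1 : wExp m ξ = ⊤) (hU2 : wExp (m - 1) ξ < ⊤) (n : ℕ) : whStarExp n ξ ≤ (m : EReal) := by
  refine sSup_le ?_
  rintro _ ⟨w, rfl, hev⟩
  rw [← EReal.coe_natCast, EReal.coe_le_coe_iff]
  by_contra! hw
  obtain ⟨C, hC1, hres⟩ := exists_one_le_resultant_bound m n hm ξ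
  obtain ⟨C₂, hC₂, hroot⟩ := exists_abs_aeval_le_of_root n ξ
  obtain ⟨T₀, hT₀⟩ := eventually_atTop.mp hev
  set δ : ℝ := w - m with hδ
  have hδ0 : 0 < δ := sub_pos.mpr hw
  obtain ⟨k, hk⟩ := exists_nat_ge δ⁻¹
  have hkδ : 1 ≤ k * δ := (inv_le_iff_one_le_mul₀ hδ0).mp hk
  set D : ℝ := 8 * C * C₂ with hD
  have hD1 : 1 ≤ D := by nlinarith
  set T : ℝ := max T₀ 1
  have hT1 : 1 ≤ T := le_max_right _ _
  obtain ⟨P, hP, hPm, hPB, hPW⟩ := exists_irreducible_approximation hm hξ hU1 hU2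
    (n + n * k * m + 1) (4 * C * D ^ (k * m) * T ^ m)
  set h := polyHeight P
  set ε := |aeval ξ P| with hε
  have hh1 : 1 ≤ h := one_le_polyHeight hP.ne_zero
  have hε0 : 0 < ε := abs_aeval_pos hξ hP.ne_zero
  have hC0 : 0 < C := one_pos.trans_le hC1
  have hh0 : 0 < h := one_pos.trans_le hh1
  have hD0 : 0 < D := one_pos.trans_le hD1
  set H : ℝ := ((4 * C * h ^ n * ε)⁻¹) ^ ((m : ℝ)⁻¹) with hH
  have hHnn : 0 ≤ H := by positivity
  have hHm : H ^ m = (4 * C * h ^ n * ε)⁻¹ := Real.rpow_inv_natCast_pow (by positivity) (by omega)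
  have hDh : 1 ≤ D * h ^ n := one_le_mul_of_one_le_of_one_le hD1 (one_le_pow₀ hh1)
  have hX1 : 1 ≤ (D * h ^ n) ^ k := one_le_pow₀ hDh
  have hXT : (D * h ^ n) ^ k * T ≤ H := by
    refine le_of_pow_le_pow_left₀ (n := m) (by omega) hHnn ?_
    rw [hHm, le_inv_comm₀ (by positivity) (by positivity), ← one_div, le_div_iff₀ (by positivity)]
    calc 4 * C * h ^ n * ε * ((D * h ^ n) ^ k * T) ^ m
        = ε * (h ^ (n + n * k * m) * (4 * C * D ^ (k * m) * T ^ m)) := by ring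
      _ ≤ ε * (h ^ (n + n * k * m) * h) := by gcongr
      _ ≤ 1 := by rwa [← pow_succ]
  have hXH : (D * h ^ n) ^ k ≤ H := (le_mul_of_one_le_right (by positivity) hT1).trans hXT
  have hH1 : 1 ≤ H := hX1.trans hXH
  have hH0 : 0 < H := one_pos.trans_le hH1
  have hTH : T₀ ≤ H := (le_max_left _ _).trans
    ((le_mul_of_one_le_left (by positivity) hX1).trans hXT)
  have hHδ : D * h ^ n ≤ H ^ δ := by
    calc D * h ^ n ≤ (D * h ^ n) ^ (k * δ) := Real.self_le_rpow_of_one_le hDh hkδ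
      _ = ((D * h ^ n) ^ k) ^ δ := by
        rw [Real.rpow_mul (by positivity), Real.rpow_natCast]
      _ ≤ H ^ δ := Real.rpow_le_rpow (by positivity) hXH hδ0.le
  obtain ⟨α, Q, hQ, hQα, hQn, hQH, -, hαle⟩ := hT₀ H hTH
  have hHQ := one_le_polyHeight hQ.ne_zero
  have hHQ0 : 0 < polyHeight Q := one_pos.trans_le hHQ
  have hw0 : 0 ≤ w := (Nat.cast_nonneg m).trans hw.le
  have hα1 : |ξ - α| ≤ 1 := hαle.trans (mul_le_one₀ (inv_le_one_of_one_le₀ hHQ)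
    (by positivity) (Real.rpow_le_one_of_one_le_of_nonpos hH1 (by linarith)))
  have hq : |aeval ξ Q| ≤ C₂ * H ^ (-w) := by
    refine (hroot Q α hQn hQα hα1).trans (mul_le_mul_of_nonneg_left ?_ (by positivity))
    rwa [← le_inv_mul_iff₀ hHQ0]
  have hsplit : H ^ w = H ^ δ * H ^ m := by
    rw [← Real.rpow_natCast, ← Real.rpow_add hH0, hδ, sub_add_cancel]
  have hqs : 8 * C * h ^ n * H ^ m * |aeval ξ Q| ≤ 1 := by
    calc 8 * C * h ^ n * H ^ m * |aeval ξ Q| ≤ 8 * C * h ^ n * H ^ m * (C₂ * H ^ (-w)) := by gcongr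
      _ = D * h ^ n / H ^ δ := by
        rw [Real.rpow_neg hH0.le, hsplit]
        field_simp
        rw [hD]
      _ ≤ 1 := div_le_one_of_le₀ hHδ (by positivity)
  have hεs : 4 * C * h ^ n * H ^ m * ε = 1 := by
    rw [hHm]
    field_simp
  by_cases hdvd : P ∣ Q
  · obtain ⟨u, hu⟩ := hdvd
    have hunit : IsUnit u := (hQ.isUnit_or_isUnit hu).resolve_left hP.not_isUnit
    obtain ⟨r, hr, rfl⟩ := isUnit_iff.mp hunit
    have hQε : |aeval ξ Q| = ε := by
      rcases Int.isUnit_iff.mp hr with rfl | rfl <;> simp [hu, hε]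
    rw [hQε] at hqs
    nlinarith
  · have h1 := hres P Q hP hPm hQn hdvd h H hh0 hH0 le_rfl hQH
    have h2 : C * (h ^ n * H ^ m * (ε / h + |aeval ξ Q| / H)) ≤
        C * (h ^ n * H ^ m * (ε + |aeval ξ Q|)) := by
      gcongr
      · exact div_le_self hε0.le hh1
      · exact div_le_self (abs_nonneg _) hH1
    linarith

theorem whExp_le_of_wExp {m : ℕ} (hm : 1 ≤ m) {ξ : ℝ} (hξ : Transcendental ℚ ξ)
    (hU1 : wExp m ξ = ⊤) (hU2 : wExp (m - 1) ξ < ⊤) (n : ℕ) :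
    whExp n ξ ≤ (m : EReal) + (n : EReal) - 1 := by
  have hcoe : (m : EReal) + (n : EReal) - 1 = ((m + n - 1 : ℝ) : EReal) := by
    push_cast
    rfl
  rw [hcoe]
  refine sSup_le ?_
  rintro _ ⟨w, rfl, hev⟩
  rw [EReal.coe_le_coe_iff]
  by_contra! hw
  obtain ⟨C, hC1, hres⟩ := exists_one_le_resultant_bound m n hm ξ
  have hC0 : 0 < C := one_pos.trans_le hC1
  set δ : ℝ := w - (m + n - 1) with hδ
  have hδ0 : 0 < δ := sub_pos.mpr hw
  set G : ℝ := 2 ^ n * (n + 1) with hG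
  have hG1 : 1 ≤ G := one_le_mul_of_one_le_of_one_le (one_le_pow₀ one_le_two) (by simp)
  have hG0 : 0 < G := one_pos.trans_le hG1
  obtain ⟨T, hT⟩ := eventually_atTop.mp (hev.and ((eventually_ge_atTop 1).and
    ((tendsto_rpow_atTop hδ0).eventually_ge_atTop (4 * C * (2 * G) ^ n))))
  obtain ⟨P, hP, hPm, hPB, hPW⟩ := exists_irreducible_approximation hm hξ hU1 hU2
    (n + m) (max (4 * C) (T * (2 * G)))
  set h := polyHeight P
  set ε := |aeval ξ P| with hε
  have hh1 : 1 ≤ h := one_le_polyHeight hP.ne_zero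
  have hh0 : 0 < h := one_pos.trans_le hh1
  have hε0 : 0 < ε := abs_aeval_pos hξ hP.ne_zero
  set H : ℝ := h / (2 * G) with hH
  have hhH : h = 2 * G * H := by
    rw [hH]
    field_simp
  obtain ⟨⟨Q, hQn, hQH, hQ0, hQle⟩, hH1, hHδ⟩ :=
    hT H ((le_div_iff₀ (by positivity)).mpr ((le_max_right _ _).trans hPB))
  have hH0 : 0 < H := one_pos.trans_le hH1
  have hQne : Q ≠ 0 := by
    rintro rfl
    simp at hQ0
  have hdvd : ¬ P ∣ Q := fun hd => by
    have h1 : h ≤ G * polyHeight Q := polyHeight_le_of_dvd hQn hQne hd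
    have h2 : G * polyHeight Q ≤ G * H := by gcongr
    nlinarith
  have h1 := hres P Q hP hPm hQn hdvd h H hh0 hH0 le_rfl hQH
  have h2 : C * (h ^ n * H ^ m * (ε / h)) ≤ 1 / 4 := by
    have hHh : H ≤ h := div_le_self hh0.le (by linarith)
    calc C * (h ^ n * H ^ m * (ε / h)) ≤ C * (h ^ n * h ^ m * (ε / h)) := by gcongr
      _ = C * (ε * h ^ (n + m)) / h := by ring
      _ ≤ C * 1 / h := by gcongr
      _ ≤ 1 / 4 := by
        rw [div_le_div_iff₀ hh0 (by norm_num)]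
        linarith [(le_max_left _ _).trans hPB]
  have hsplit : H ^ w * H = H ^ δ * (H ^ n * H ^ m) := by
    rw [← Real.rpow_natCast, ← Real.rpow_natCast, ← Real.rpow_add hH0, ← Real.rpow_add hH0,
      ← Real.rpow_add_one hH0.ne']
    congr 1
    rw [hδ]
    ring
  have h3 : C * (h ^ n * H ^ m * (|aeval ξ Q| / H)) ≤ 1 / 4 := by
    calc C * (h ^ n * H ^ m * (|aeval ξ Q| / H))
        ≤ C * (h ^ n * H ^ m * (H ^ (-w) / H)) := by gcongr
      _ = C * (2 * G) ^ n * (H ^ n * H ^ m) / (H ^ w * H) := by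
        rw [Real.rpow_neg hH0.le, hhH, mul_pow]
        field_simp
      _ = C * (2 * G) ^ n / H ^ δ := by
        rw [hsplit]
        field_simp
      _ ≤ 1 / 4 := by
        rw [div_le_div_iff₀ (by positivity) (by norm_num)]
        linarith
  have h4 : C * (h ^ n * H ^ m * (ε / h + |aeval ξ Q| / H)) =
      C * (h ^ n * H ^ m * (ε / h)) + C * (h ^ n * H ^ m * (|aeval ξ Q| / H)) := by ring
  linarith

theorem stmt10 (m : ℕ) (hm : 1 ≤ m) (ξ : ℝ) (hξ : Transcendental ℚ ξ)
    (hU1 : wExp m ξ = ⊤) (hU2 : wExp (m - 1) ξ < ⊤) :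
    ∀ n : ℕ, 1 ≤ n →
      whStarExp n ξ ≤ (m : EReal) ∧ whExp n ξ ≤ (m : EReal) + (n : EReal) - 1 :=
  fun n _ => ⟨whStarExp_le_of_wExp hm hξ hU1 hU2 n, whExp_le_of_wExp hm hξ hU1 hU2 n⟩
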